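/- arXiv:2411.09352 — 6 statements merged into one kernel-verified Lean document; each statement's English description precedes it below -/
import Mathlib

section
/- Assume ρ(p,S) > 0 and ρ_p(p,S) > 0 for all (p,S), and set Â_j(U) = A₀(U)⁻¹A_j(U). Then for every U′ ∈ N and for j = 1,2, the matrix Â_j(U′) maps N into N and maps N^⊥ into N^⊥. -/
open Matrix

noncomputable section

/- The state vector is `U : Fin 8 → ℝ` with `p = U 0`, `u = (U 1, U 2, U 3)`,
`H = (U 4, U 5, U 6)`, `S = U 7`.  The state equation `ρ = ρ(p,S)` and its
partial derivative `ρ_p = ∂ρ/∂p` are given as curried functions `ℝ → ℝ → ℝ`. -/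

/-- `A₀(U) = blockdiag(ρ_p/ρ, ρ I₃, I₃, 1)`. -/
def A0mat (ρ ρp : ℝ → ℝ → ℝ) (U : Fin 8 → ℝ) : Matrix (Fin 8) (Fin 8) ℝ :=
  Matrix.diagonal fun i =>
    if (i : ℕ) = 0 then ρp (U 0) (U 7) / ρ (U 0) (U 7)
    else if (i : ℕ) ≤ 3 then ρ (U 0) (U 7)
    else 1

/-- `A_j(U)`, `j : Fin 3` (so `j = 0,1,2` corresponds to `x₁,x₂,x₃`): the 8×8 matrix
with blocks (p,p)-entry `(ρ_p/ρ)u_j`; (p,u)-block the row vector `δ_j`; (u,p)-block `δ_jᵀ`;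
(u,u)-block `ρ u_j I₃`; (u,H)-block `δ_j ⊗ H − H_j I₃` (where `(δ_j ⊗ H)_{k i} = δ_{j k} H_i`);
(H,u)-block `(δ_j ⊗ H)ᵀ − H_j I₃`; (H,H)-block `u_j I₃`; (S,S)-entry `u_j`; all other
entries zero. -/
def Amat (ρ ρp : ℝ → ℝ → ℝ) (j : Fin 3) (U : Fin 8 → ℝ) : Matrix (Fin 8) (Fin 8) ℝ :=
  Matrix.of fun i k =>
    let a : ℕ := (i : ℕ)
    let b : ℕ := (k : ℕ)
    let uj : ℝ := U ⟨1 + (j : ℕ), by have := j.isLt; omega⟩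
    let Hj : ℝ := U ⟨4 + (j : ℕ), by have := j.isLt; omega⟩
    if a = 0 ∧ b = 0 then ρp (U 0) (U 7) / ρ (U 0) (U 7) * uj
    else if a = 0 ∧ 1 ≤ b ∧ b ≤ 3 then (if b = 1 + (j : ℕ) then 1 else 0)
    else if 1 ≤ a ∧ a ≤ 3 ∧ b = 0 then (if a = 1 + (j : ℕ) then 1 else 0)
    else if 1 ≤ a ∧ a ≤ 3 ∧ 1 ≤ b ∧ b ≤ 3 then
      (if a = b then ρ (U 0) (U 7) * uj else 0)
    else if 1 ≤ a ∧ a ≤ 3 ∧ 4 ≤ b ∧ b ≤ 6 then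
      (if a = 1 + (j : ℕ) then U k else 0) - (if b = a + 3 then Hj else 0)
    else if 4 ≤ a ∧ a ≤ 6 ∧ 1 ≤ b ∧ b ≤ 3 then
      (if b = 1 + (j : ℕ) then U i else 0) - (if a = b + 3 then Hj else 0)
    else if 4 ≤ a ∧ a ≤ 6 ∧ 4 ≤ b ∧ b ≤ 6 then (if a = b then uj else 0)
    else if a = 7 ∧ b = 7 then uj
    else 0

/-- `N = {V ∈ ℝ⁸ : V₄ = V₇ = 0}` (0-indexed: components `3` and `6`, i.e. `u₃` and `H₃`). -/
def Nset : Set (Fin 8 → ℝ) := {V | V 3 = 0 ∧ V 6 = 0}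

/-- `N^⊥ = {V ∈ ℝ⁸ : V₁ = V₂ = V₃ = V₅ = V₆ = V₈ = 0}` (0-indexed components
`0,1,2,4,5,7`). -/
def Nperp : Set (Fin 8 → ℝ) :=
  {V | V 0 = 0 ∧ V 1 = 0 ∧ V 2 = 0 ∧ V 4 = 0 ∧ V 5 = 0 ∧ V 7 = 0}

/-- `Â_j(U) = A₀(U)⁻¹ A_j(U)`. -/
def Ahat (ρ ρp : ℝ → ℝ → ℝ) (j : Fin 3) (U : Fin 8 → ℝ) : Matrix (Fin 8) (Fin 8) ℝ :=
  (A0mat ρ ρp U)⁻¹ * Amat ρ ρp j U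

/-- As `A₀(U)` is diagonal, every component that vanishes in `A_j(U) V` vanishes in `Â_j(U) V`. -/
theorem Ahat_mulVec_eq_zero (ρ ρp : ℝ → ℝ → ℝ) (j : Fin 3) (U V : Fin 8 → ℝ) {i : Fin 8}
    (h : (Amat ρ ρp j U).mulVec V i = 0) : (Ahat ρ ρp j U).mulVec V i = 0 := by
  rw [Ahat, A0mat, ← Matrix.mulVec_mulVec, Matrix.inv_diagonal, Matrix.mulVec_diagonal, h,
    mul_zero]

/-- for `U′ ∈ N` and `j = 1,2` (indices `j : Fin 3` with `j < 2`),
`Â_j(U′) = A₀(U′)⁻¹ A_j(U′)` maps `N` into `N` and `N^⊥` into `N^⊥`. -/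
theorem statement1 (ρ ρp : ℝ → ℝ → ℝ)
    (hρ : ∀ p S, 0 < ρ p S) (hρp : ∀ p S, 0 < ρp p S)
    (U' : Fin 8 → ℝ) (hU' : U' ∈ Nset)
    (j : Fin 3) (hj : (j : ℕ) < 2) :
    (∀ V ∈ Nset, (Ahat ρ ρp j U').mulVec V ∈ Nset) ∧
      (∀ V ∈ Nperp, (Ahat ρ ρp j U').mulVec V ∈ Nperp) := by
  obtain ⟨-, hU6⟩ := hU'
  have hj' : j = 0 ∨ j = 1 := by omega
  constructor
  · rintro V ⟨h3, h6⟩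
    refine ⟨?_, ?_⟩ <;> apply Ahat_mulVec_eq_zero <;> rcases hj' with rfl | rfl <;>
      simp [Amat, Matrix.mulVec, dotProduct, Fin.sum_univ_eight, h3, h6, hU6]
  · rintro V ⟨h0, h1, h2, h4, h5, h7⟩
    refine ⟨?_, ?_, ?_, ?_, ?_, ?_⟩ <;> apply Ahat_mulVec_eq_zero <;>
      rcases hj' with rfl | rfl <;>
      simp [Amat, Matrix.mulVec, dotProduct, Fin.sum_univ_eight, h0, h1, h2, h4, h5, h7, hU6]
end
end

section
/- Assume ρ(p,S) > 0 and ρ_p(p,S) > 0 for all (p,S), and set Â₃(U) = A₀(U)⁻¹A₃(U). Then for every U′ ∈ N, the matrix Â₃(U′) maps N into N^⊥ and maps N^⊥ into N. -/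
open Matrix

noncomputable section

/-- Since `A₀` is diagonal, its inverse only rescales each component of `A_j V`. -/
theorem Ahat_mulVec_apply (ρ ρp : ℝ → ℝ → ℝ) (j : Fin 3) (U V : Fin 8 → ℝ) (i : Fin 8) :
    ∃ c : ℝ, (Ahat ρ ρp j U).mulVec V i = c * (Amat ρ ρp j U).mulVec V i := by
  rw [Ahat, A0mat, Matrix.inv_diagonal, ← Matrix.mulVec_mulVec]
  exact ⟨_, Matrix.mulVec_diagonal _ _ _⟩

theorem Ahat_mulVec_apply_eq_zero {ρ ρp : ℝ → ℝ → ℝ} {j : Fin 3} {U V : Fin 8 → ℝ} {i : Fin 8}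
    (h : (Amat ρ ρp j U).mulVec V i = 0) : (Ahat ρ ρp j U).mulVec V i = 0 := by
  obtain ⟨c, hc⟩ := Ahat_mulVec_apply ρ ρp j U V i
  rw [hc, h, mul_zero]

/-- for `U′ ∈ N`, the matrix `Â₃(U′) = A₀(U′)⁻¹ A₃(U′)` (index `2 : Fin 3`)
maps `N` into `N^⊥` and `N^⊥` into `N`. -/
theorem statement2 (ρ ρp : ℝ → ℝ → ℝ)
    (hρ : ∀ p S, 0 < ρ p S) (hρp : ∀ p S, 0 < ρp p S)
    (U' : Fin 8 → ℝ) (hU' : U' ∈ Nset) :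
    (∀ V ∈ Nset, (Ahat ρ ρp 2 U').mulVec V ∈ Nperp) ∧
      (∀ V ∈ Nperp, (Ahat ρ ρp 2 U').mulVec V ∈ Nset) := by
  have hu : U' 3 = 0 := hU'.1
  have hH : U' 6 = 0 := hU'.2
  constructor
  · rintro V ⟨hV3, -⟩
    refine ⟨?_, ?_, ?_, ?_, ?_, ?_⟩ <;> apply Ahat_mulVec_apply_eq_zero <;>
      simp [Amat, Matrix.mulVec, dotProduct, Fin.sum_univ_eight, hu, hH, hV3]
  · rintro V ⟨hV0, -, -, hV4, hV5, -⟩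
    refine ⟨?_, ?_⟩ <;> apply Ahat_mulVec_apply_eq_zero <;>
      simp [Amat, Matrix.mulVec, dotProduct, Fin.sum_univ_eight, hu, hH, hV0, hV4, hV5]
end
end

section
/- For every U′ ∈ N (i.e. a state with u₃′ = H₃′ = 0), the boundary matrix A₃(U′) has rank exactly 2. -/
open Matrix

noncomputable section

/-- On `N` the boundary matrix `A₃` is the symmetrized outer product of the basis vector of the
`u₃`-direction and the vector `(1, 0, 0, 0, H₁, H₂, 0, 0)`, written as a product through `ℝ²`. -/
theorem Amat_two_eq_mul (ρ ρp : ℝ → ℝ → ℝ) {U : Fin 8 → ℝ} (hU : U ∈ Nset) :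
    Amat ρ ρp 2 U =
      (of ![Pi.single 3 1, ![1, 0, 0, 0, U 4, U 5, 0, 0]] : Matrix (Fin 2) (Fin 8) ℝ)ᵀ *
        (of ![![1, 0, 0, 0, U 4, U 5, 0, 0], Pi.single 3 1] : Matrix (Fin 2) (Fin 8) ℝ) := by
  obtain ⟨h3, h6⟩ := hU
  ext i k
  fin_cases i <;> fin_cases k <;>
    simp [Amat, Matrix.mul_apply, Fin.sum_univ_two, h3, h6]

/-- On `N` the rows and columns of the boundary matrix `A₃` belonging to `p` and `u₃` form an
identity matrix up to a permutation. -/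
theorem Amat_two_submatrix (ρ ρp : ℝ → ℝ → ℝ) {U : Fin 8 → ℝ} (hU : U ∈ Nset) :
    (Amat ρ ρp 2 U).submatrix ![0, 3] ![3, 0] = (1 : Matrix (Fin 2) (Fin 2) ℝ) := by
  obtain ⟨h3, -⟩ := hU
  ext i k
  fin_cases i <;> fin_cases k <;> simp [Amat, h3]

/-- for every `U′ ∈ N` (i.e. `u₃′ = H₃′ = 0`), the boundary matrix
`A₃(U′)` (the matrix `Amat` with index `2 : Fin 3`) has rank exactly `2`. -/
theorem statement6 (ρ ρp : ℝ → ℝ → ℝ)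
    (U' : Fin 8 → ℝ) (hU' : U' ∈ Nset) :
    (Amat ρ ρp 2 U').rank = 2 := by
  apply le_antisymm
  · rw [Amat_two_eq_mul ρ ρp hU']
    exact (rank_mul_le_right _ _).trans (rank_le_height _)
  · have h := rank_submatrix_le (Amat ρ ρp 2 U') ![0, 3] ![3, 0]
    rwa [Amat_two_submatrix ρ ρp hU', rank_one, Fintype.card_fin] at h
end
end

section
/- For every U′ = (p′,u′,H′,S′) ∈ ℝ⁸ with u′ = 0 and H₁′ ≠ 0, the boundary matrix A₁(U′) has rank exactly 6. -/
open Matrix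

noncomputable section

/-- A matrix that factors through `Fin n` and has the identity matrix of size `n` as a two-sided
compression has rank `n`. -/
theorem Matrix.rank_eq_of_factorization {m p : Type*} [Fintype m] [Fintype p]
    {n : ℕ} {A : Matrix m p ℝ} (L : Matrix (Fin n) m ℝ) (R : Matrix p (Fin n) ℝ)
    (C : Matrix m (Fin n) ℝ) (D : Matrix (Fin n) p ℝ) (hLR : L * A * R = 1) (hCD : A = C * D) :
    A.rank = n := by
  apply le_antisymm
  · rw [hCD]
    exact (Matrix.rank_mul_le_left C D).trans (by simpa using Matrix.rank_le_card_width C)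
  · calc n = (L * A * R).rank := by rw [hLR, Matrix.rank_one, Fintype.card_fin]
      _ ≤ (L * A).rank := Matrix.rank_mul_le_left _ _
      _ ≤ A.rank := Matrix.rank_mul_le_right _ _

/-- The explicit form of the boundary matrix `A₁(U)` for a state with zero velocity. -/
theorem Amat_zero_eq_of_velocity_eq_zero (ρ ρp : ℝ → ℝ → ℝ) (U : Fin 8 → ℝ) (hu : U 1 = 0) :
    Amat ρ ρp 0 U =
      !![0, 1, 0, 0, 0, 0, 0, 0;
         1, 0, 0, 0, 0, U 5, U 6, 0;
         0, 0, 0, 0, 0, -U 4, 0, 0;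
         0, 0, 0, 0, 0, 0, -U 4, 0;
         0, 0, 0, 0, 0, 0, 0, 0;
         0, U 5, -U 4, 0, 0, 0, 0, 0;
         0, U 6, 0, -U 4, 0, 0, 0, 0;
         0, 0, 0, 0, 0, 0, 0, 0] := by
  ext i k
  fin_cases i <;> fin_cases k <;> simp [Amat, hu]

set_option maxHeartbeats 1000000 in
/-- for every state `U′` with `u′ = 0` and `H₁′ ≠ 0` (0-indexed:
`U′ 4 ≠ 0`), the boundary matrix `A₁(U′)` (the matrix `Amat` with index `0 : Fin 3`)
has rank exactly `6`. -/
theorem statement7 (ρ ρp : ℝ → ℝ → ℝ)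
    (U' : Fin 8 → ℝ) (hu1 : U' 1 = 0) (hu2 : U' 2 = 0) (hu3 : U' 3 = 0)
    (hH1 : U' 4 ≠ 0) :
    (Amat ρ ρp 0 U').rank = 6 := by
  have hA := Amat_zero_eq_of_velocity_eq_zero ρ ρp U' hu1
  let f : Fin 6 → Fin 8 := ![0, 1, 2, 3, 5, 6]
  refine Matrix.rank_eq_of_factorization
    !![0, 1, U' 5 / U' 4, U' 6 / U' 4, 0, 0, 0, 0;
       1, 0, 0, 0, 0, 0, 0, 0;
       U' 5 / U' 4, 0, 0, 0, 0, -(U' 4)⁻¹, 0, 0;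
       U' 6 / U' 4, 0, 0, 0, 0, 0, -(U' 4)⁻¹, 0;
       0, 0, -(U' 4)⁻¹, 0, 0, 0, 0, 0;
       0, 0, 0, -(U' 4)⁻¹, 0, 0, 0, 0]
    ((1 : Matrix (Fin 8) (Fin 8) ℝ).submatrix id f)
    !![0, 1, 0, 0, 0, 0;
       1, 0, 0, 0, U' 5, U' 6;
       0, 0, 0, 0, -U' 4, 0;
       0, 0, 0, 0, 0, -U' 4;
       0, 0, 0, 0, 0, 0;
       0, U' 5, -U' 4, 0, 0, 0;
       0, U' 6, 0, -U' 4, 0, 0;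
       0, 0, 0, 0, 0, 0]
    !![1, 0, 0, 0, 0, 0, 0, 0;
       0, 1, 0, 0, 0, 0, 0, 0;
       0, 0, 1, 0, 0, 0, 0, 0;
       0, 0, 0, 1, 0, 0, 0, 0;
       0, 0, 0, 0, 0, 1, 0, 0;
       0, 0, 0, 0, 0, 0, 1, 0] ?_ ?_
  · rw [hA]
    ext i k
    fin_cases i <;> fin_cases k <;>
      simp [f, Matrix.mul_apply, Fin.sum_univ_succ, Matrix.one_apply, hH1] <;>
      ring
  · rw [hA]
    ext i k
    fin_cases i <;> fin_cases k <;> simp [Matrix.mul_apply, Fin.sum_univ_succ]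
end
end

section
/- Let R = diag(1,1,1,−1,1,1,−1,1) be the 8×8 reflection matrix flipping the u₃ and H₃ components. Then for every U ∈ ℝ⁸ one has the equivariance identities A₀(RU) = R A₀(U) R, A₁(RU) = R A₁(U) R, A₂(RU) = R A₂(U) R, and A₃(RU) = −R A₃(U) R. -/
open Matrix

noncomputable section

/-- `R = diag(1,1,1,−1,1,1,−1,1)`: the reflection flipping the `u₃` and `H₃`
components (0-indexed components `3` and `6`). -/
def Rmat : Matrix (Fin 8) (Fin 8) ℝ :=
  Matrix.diagonal fun i => if (i : ℕ) = 3 ∨ (i : ℕ) = 6 then -1 else 1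

/-- Diagonal entries of the reflection `R`. -/
def reflSign (i : Fin 8) : ℝ := if (i : ℕ) = 3 ∨ (i : ℕ) = 6 then -1 else 1

lemma Rmat_mulVec_apply (U : Fin 8 → ℝ) (i : Fin 8) :
    Rmat.mulVec U i = reflSign i * U i :=
  mulVec_diagonal _ _ _

lemma Rmat_conj_apply (M : Matrix (Fin 8) (Fin 8) ℝ) (i k : Fin 8) :
    (Rmat * M * Rmat) i k = reflSign i * M i k * reflSign k := by
  simp [Rmat, reflSign, Matrix.mul_diagonal, Matrix.diagonal_mul]

lemma A0mat_Rmat_mulVec (ρ ρp : ℝ → ℝ → ℝ) (U : Fin 8 → ℝ) :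
    A0mat ρ ρp (Rmat.mulVec U) = Rmat * A0mat ρ ρp U * Rmat := by
  ext i k
  rw [Rmat_conj_apply]
  by_cases h : i = k
  · subst h
    fin_cases i <;> simp [A0mat, Rmat_mulVec_apply, reflSign]
  · simp [A0mat, h]

set_option maxHeartbeats 1000000 in
lemma Amat_zero_Rmat_mulVec (ρ ρp : ℝ → ℝ → ℝ) (U : Fin 8 → ℝ) :
    Amat ρ ρp 0 (Rmat.mulVec U) = Rmat * Amat ρ ρp 0 U * Rmat := by
  ext i k
  rw [Rmat_conj_apply]
  fin_cases i <;> fin_cases k <;> simp [Amat, Rmat_mulVec_apply, reflSign]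

set_option maxHeartbeats 1000000 in
lemma Amat_one_Rmat_mulVec (ρ ρp : ℝ → ℝ → ℝ) (U : Fin 8 → ℝ) :
    Amat ρ ρp 1 (Rmat.mulVec U) = Rmat * Amat ρ ρp 1 U * Rmat := by
  ext i k
  rw [Rmat_conj_apply]
  fin_cases i <;> fin_cases k <;> simp [Amat, Rmat_mulVec_apply, reflSign]

set_option maxHeartbeats 1000000 in
lemma Amat_two_Rmat_mulVec (ρ ρp : ℝ → ℝ → ℝ) (U : Fin 8 → ℝ) :
    Amat ρ ρp 2 (Rmat.mulVec U) = -(Rmat * Amat ρ ρp 2 U * Rmat) := by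
  ext i k
  rw [Matrix.neg_apply, Rmat_conj_apply]
  fin_cases i <;> fin_cases k <;> simp [Amat, Rmat_mulVec_apply, reflSign]

/-- the equivariance identities `A₀(RU) = R A₀(U) R`,
`A₁(RU) = R A₁(U) R`, `A₂(RU) = R A₂(U) R`, `A₃(RU) = −R A₃(U) R`. -/
theorem statement8 (ρ ρp : ℝ → ℝ → ℝ) (U : Fin 8 → ℝ) :
    A0mat ρ ρp (Rmat.mulVec U) = Rmat * A0mat ρ ρp U * Rmat ∧
    Amat ρ ρp 0 (Rmat.mulVec U) = Rmat * Amat ρ ρp 0 U * Rmat ∧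
    Amat ρ ρp 1 (Rmat.mulVec U) = Rmat * Amat ρ ρp 1 U * Rmat ∧
    Amat ρ ρp 2 (Rmat.mulVec U) = -(Rmat * Amat ρ ρp 2 U * Rmat) :=
  ⟨A0mat_Rmat_mulVec ρ ρp U, Amat_zero_Rmat_mulVec ρ ρp U, Amat_one_Rmat_mulVec ρ ρp U,
    Amat_two_Rmat_mulVec ρ ρp U⟩
end
end

section
/- Assume ρ is C¹ with ρ(p,S) > 0 and ρ_p(p,S) > 0 for all (p,S), and set Â_j(U) = A₀(U)⁻¹A_j(U). Let O ⊆ ℝ³ be an open set meeting the plane {x₃ = 0}, and let U⁰ : O → ℝ⁸ be differentiable with U⁰(x) ∈ N and ∂₃U⁰(x) ∈ N^⊥ for every x ∈ O with x₃ = 0. Then the vector ∂_tU⁰ := −Σ_{j=1}^{3} Â_j(U⁰)∂_jU⁰ (the formal time derivative determined by the MHD system) satisfies ∂_tU⁰(x) ∈ N for every x ∈ O with x₃ = 0. -/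
open Matrix

noncomputable section

/-- The derivative of a function vanishing on the part of a hyperplane `{x₃ = 0}` inside an open set
vanishes along the directions tangent to that hyperplane. -/
theorem fderiv_apply_eq_zero_of_tangent {n : Type*} [Fintype n] {U : (Fin 3 → ℝ) → n → ℝ}
    {O : Set (Fin 3 → ℝ)} (hO : IsOpen O) {x v : Fin 3 → ℝ} (hx : x ∈ O) (hx2 : x 2 = 0)
    (hv : v 2 = 0) (hU : DifferentiableAt ℝ U x) {i : n}
    (hi : ∀ y ∈ O, y 2 = 0 → U y i = 0) : fderiv ℝ U x v i = 0 := by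
  have hderiv : HasDerivAt (fun t : ℝ => U (x + t • v) i) (fderiv ℝ U x v i) 0 :=
    hasDerivAt_pi.1 (hU.hasFDerivAt.hasLineDerivAt v) i
  have hmem : ∀ᶠ t : ℝ in nhds 0, x + t • v ∈ O :=
    (show Continuous fun t : ℝ => x + t • v by fun_prop).continuousAt.eventually_mem
      (hO.mem_nhds (by simpa using hx))
  have hzero : (fun t : ℝ => U (x + t • v) i) =ᶠ[nhds 0] fun _ => 0 := by
    filter_upwards [hmem] with t ht
    exact hi _ ht (by simp [hx2, hv])
  exact hderiv.unique ((hasDerivAt_const (0 : ℝ) (0 : ℝ)).congr_of_eventuallyEq hzero)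

theorem Ahat_mulVec_mem_Nset {ρ ρp : ℝ → ℝ → ℝ} {j : Fin 3} {U V : Fin 8 → ℝ}
    (h : (Amat ρ ρp j U).mulVec V ∈ Nset) : (Ahat ρ ρp j U).mulVec V ∈ Nset := by
  obtain ⟨h3, h6⟩ := h
  rw [Ahat, A0mat, Matrix.inv_diagonal, ← Matrix.mulVec_mulVec]
  exact ⟨by rw [Matrix.mulVec_diagonal, h3, mul_zero],
    by rw [Matrix.mulVec_diagonal, h6, mul_zero]⟩

theorem Amat_mulVec_mem_Nset_of_ne {ρ ρp : ℝ → ℝ → ℝ} {j : Fin 3} (hj : j ≠ 2)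
    {U V : Fin 8 → ℝ} (hU : U ∈ Nset) (hV : V ∈ Nset) : (Amat ρ ρp j U).mulVec V ∈ Nset := by
  obtain ⟨-, hU6⟩ := hU
  obtain ⟨hV3, hV6⟩ := hV
  fin_cases j
  · constructor <;> simp [Matrix.mulVec, dotProduct, Fin.sum_univ_eight, Amat, hU6, hV3, hV6]
  · constructor <;> simp [Matrix.mulVec, dotProduct, Fin.sum_univ_eight, Amat, hU6, hV3, hV6]
  · exact absurd rfl hj

theorem Amat_two_mulVec_mem_Nset {ρ ρp : ℝ → ℝ → ℝ} {U V : Fin 8 → ℝ} (hU : U ∈ Nset)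
    (hV : V ∈ Nperp) : (Amat ρ ρp 2 U).mulVec V ∈ Nset := by
  obtain ⟨hU3, hU6⟩ := hU
  obtain ⟨h0, -, -, h4, h5, -⟩ := hV
  constructor <;>
    simp [Matrix.mulVec, dotProduct, Fin.sum_univ_eight, Amat, hU3, hU6, h0, h4, h5]

/-- if `ρ` is `C¹` with `ρ > 0`, `ρ_p > 0`, `O ⊆ ℝ³` is open and meets
the plane `{x₃ = 0}`, and `U⁰ : O → ℝ⁸` is differentiable with `U⁰ ∈ N` and
`∂₃U⁰ ∈ N^⊥` at every point of `O ∩ {x₃ = 0}`, then the formal time derivative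
`∂_tU⁰ = −Σ_j Â_j(U⁰) ∂_jU⁰` lies in `N` at every point of `O ∩ {x₃ = 0}`. -/
theorem statement14 (ρ ρp : ℝ → ℝ → ℝ)
    (hρC1 : ContDiff ℝ 1 (fun q : ℝ × ℝ => ρ q.1 q.2))
    (hρ : ∀ p S, 0 < ρ p S) (hρp : ∀ p S, 0 < ρp p S)
    (O : Set (Fin 3 → ℝ)) (hO : IsOpen O) (hmeet : ∃ x ∈ O, x 2 = 0)
    (U0 : (Fin 3 → ℝ) → Fin 8 → ℝ)
    (hdiff : ∀ x ∈ O, DifferentiableAt ℝ U0 x)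
    (hbc : ∀ x ∈ O, x 2 = 0 →
      U0 x ∈ Nset ∧ fderiv ℝ U0 x (Pi.single 2 1) ∈ Nperp) :
    ∀ x ∈ O, x 2 = 0 →
      (-∑ j : Fin 3, (Ahat ρ ρp j (U0 x)).mulVec (fderiv ℝ U0 x (Pi.single j 1)))
        ∈ Nset := by
  intro x hx hx2
  obtain ⟨hU, hnormal⟩ := hbc x hx hx2
  have hterm (j : Fin 3) :
      (Ahat ρ ρp j (U0 x)).mulVec (fderiv ℝ U0 x (Pi.single j 1)) ∈ Nset := by
    apply Ahat_mulVec_mem_Nset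
    by_cases hj : j = 2
    · subst hj
      exact Amat_two_mulVec_mem_Nset hU hnormal
    · have hv : (Pi.single j 1 : Fin 3 → ℝ) 2 = 0 := Pi.single_eq_of_ne' hj 1
      exact Amat_mulVec_mem_Nset_of_ne hj hU
        ⟨fderiv_apply_eq_zero_of_tangent hO hx hx2 hv (hdiff x hx)
            fun y hy hy2 => (hbc y hy hy2).1.1,
          fderiv_apply_eq_zero_of_tangent hO hx hx2 hv (hdiff x hx)
            fun y hy hy2 => (hbc y hy hy2).1.2⟩
  constructor
  · rw [Pi.neg_apply, Finset.sum_apply, Finset.sum_eq_zero fun j _ => (hterm j).1, neg_zero]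
  · rw [Pi.neg_apply, Finset.sum_apply, Finset.sum_eq_zero fun j _ => (hterm j).2, neg_zero]
end
end
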